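/- (Double parabolic decomposition.) Let (W,S) be a Coxeter system of finite rank, let I, J ⊆ S, and let w ∈ W satisfy ℓ(sw) > ℓ(w) for all s ∈ I and ℓ(ws) > ℓ(w) for all s ∈ J. Set H := I ∩ (w J w⁻¹) = { s ∈ I : w⁻¹ s w ∈ J }. Then: (1) for u ∈ W_I, the element u w has no right descent in J if and only if u is the minimal-length representative of its coset u W_H in W_I; and (2) every element y of W_I w W_J can be written uniquely as y = u w v where u ∈ W_I is the minimal-length representative of u W_H, v ∈ W_J, and ℓ(u w v) = ℓ(u) + ℓ(w) + ℓ(v). -/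

import Mathlib

open CoxeterSystem

variable {B : Type*} {W : Type*} [Group W]

/-- The standard parabolic subgroup `W_I` of a Coxeter system, generated by the
simple reflections indexed by `I`. -/
def CoxeterSystem.parabolic {M : CoxeterMatrix B} (cs : CoxeterSystem M W) (I : Set B) :
    Subgroup W :=
  Subgroup.closure (cs.simple '' I)

/-- The parabolic double coset `W_I w W_J`. -/
def CoxeterSystem.doubleCoset {M : CoxeterMatrix B} (cs : CoxeterSystem M W) (I : Set B)
    (w : W) (J : Set B) : Set W :=
  {x | ∃ u ∈ cs.parabolic I, ∃ v ∈ cs.parabolic J, x = u * w * v}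

namespace CoxeterSystem

variable {M : CoxeterMatrix B} (cs : CoxeterSystem M W)

/-! ### The parity of inversions and the strong exchange condition -/

open Classical in
/-- The action of a simple reflection on pairs `(t, ε)`: conjugate `t`, and flip `ε` exactly when
`t` is that simple reflection. -/
noncomputable def inversionStep (i : B) : Function.End (W × ZMod 2) :=
  fun p ↦ (cs.simple i * p.1 * cs.simple i, p.2 + if p.1 = cs.simple i then 1 else 0)

theorem simple_mul_simple_mul_simple_pow (i j : B) (n : ℕ) :
    cs.simple j * (cs.simple i * cs.simple j) ^ n =
      ((cs.simple i * cs.simple j) ^ n)⁻¹ * cs.simple j := by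
  have h : cs.simple j * (cs.simple i * cs.simple j) * (cs.simple j)⁻¹ =
      (cs.simple i * cs.simple j)⁻¹ := by simp [mul_assoc]
  rw [← inv_pow, ← h, conj_pow]
  simp [mul_assoc]

open Classical in
theorem inversionStep_mul_pow_smul (i j : B) (n : ℕ) (p : W × ZMod 2) :
    ((cs.inversionStep i * cs.inversionStep j) ^ n) • p =
      ((cs.simple i * cs.simple j) ^ n * p.1 * ((cs.simple i * cs.simple j) ^ n)⁻¹,
        p.2 + ∑ l ∈ Finset.range (2 * n),
          if p.1 = ((cs.simple i * cs.simple j) ^ l)⁻¹ * cs.simple j then 1 else 0) := by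
  induction n with
  | zero => simp
  | succ n ih =>
    have key := cs.simple_mul_simple_mul_simple_pow i j n
    rw [pow_succ', mul_smul, ih, mul_smul]
    set r := cs.simple i * cs.simple j with hr
    have h₁ : r ^ n * p.1 * (r ^ n)⁻¹ = cs.simple j ↔ p.1 = (r ^ (2 * n))⁻¹ * cs.simple j := by
      rw [mul_inv_eq_iff_eq_mul, key, ← eq_inv_mul_iff_mul_eq, ← mul_assoc, ← mul_inv_rev,
        ← pow_add, two_mul]
    have h₂ : cs.simple j * (r ^ n * p.1 * (r ^ n)⁻¹) * cs.simple j = cs.simple i ↔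
        p.1 = (r ^ (2 * n + 1))⁻¹ * cs.simple j := by
      have e : (cs.simple j)⁻¹ * (cs.simple i * (cs.simple j)⁻¹) = r⁻¹ * cs.simple j := by
        simp [hr, mul_assoc]
      have e' : (r ^ n)⁻¹ * (r⁻¹ * cs.simple j) * r ^ n = (r ^ (2 * n + 1))⁻¹ * cs.simple j := by
        rw [mul_assoc, mul_assoc, key, ← mul_assoc, ← mul_assoc, ← mul_inv_rev, ← mul_inv_rev,
          ← pow_succ', ← pow_add, two_mul, add_assoc]
      rw [← eq_mul_inv_iff_mul_eq, ← eq_inv_mul_iff_mul_eq, e, mul_inv_eq_iff_eq_mul,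
        ← eq_inv_mul_iff_mul_eq, ← mul_assoc, e']
    rw [mul_add, mul_one, Finset.sum_range_succ, Finset.sum_range_succ]
    simp only [Function.End.smul_def, inversionStep, h₁, h₂]
    refine Prod.ext ?_ ?_
    · simp only [pow_succ', mul_inv_rev, hr, inv_simple, mul_assoc]
    · simp only [add_assoc]

theorem isLiftable_inversionStep : M.IsLiftable cs.inversionStep := by
  classical
  intro i j
  have h := cs.simple_mul_simple_pow i j
  suffices ∀ p : W × ZMod 2, (cs.inversionStep i * cs.inversionStep j) ^ M i j • p = p from
    funext this
  intro p
  rw [inversionStep_mul_pow_smul, h, two_mul, Finset.sum_range_add]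
  simp only [pow_add, h, one_mul]
  simp [CharTwo.add_self_eq_zero]

/-- The action of a Coxeter group on pairs `(t, ε)` induced by `inversionStep`. -/
noncomputable def inversionHom : W →* Function.End (W × ZMod 2) :=
  cs.lift ⟨cs.inversionStep, cs.isLiftable_inversionStep⟩

theorem inversionHom_simple (i : B) : cs.inversionHom (cs.simple i) = cs.inversionStep i :=
  cs.lift_apply_simple cs.isLiftable_inversionStep i

open Classical in
theorem inversionHom_wordProd_smul (ω : List B) (p : W × ZMod 2) :
    cs.inversionHom (cs.wordProd ω) • p =
      (cs.wordProd ω * p.1 * (cs.wordProd ω)⁻¹, p.2 + (cs.rightInvSeq ω).count p.1) := by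
  induction ω with
  | nil => simp
  | cons i ω ih =>
    have h : cs.wordProd ω * p.1 * (cs.wordProd ω)⁻¹ = cs.simple i ↔
        (cs.wordProd ω)⁻¹ * cs.simple i * cs.wordProd ω = p.1 := by
      rw [mul_inv_eq_iff_eq_mul, ← eq_inv_mul_iff_mul_eq, mul_assoc, eq_comm]
    rw [wordProd_cons, map_mul, mul_smul, ih, inversionHom_simple]
    simp only [Function.End.smul_def, inversionStep, h, rightInvSeq, List.count_cons, beq_iff_eq]
    refine Prod.ext ?_ ?_
    · simp [mul_assoc]
    · simp [add_assoc]

/-- The parity of the number of occurrences of `t` in the right inversion sequence of any word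
for `w`. -/
noncomputable def inversionParity (w t : W) : ZMod 2 :=
  (cs.inversionHom w • ((t, 0) : W × ZMod 2)).2

open Classical in
theorem inversionParity_wordProd (ω : List B) (t : W) :
    cs.inversionParity (cs.wordProd ω) t = (cs.rightInvSeq ω).count t := by
  rw [inversionParity, inversionHom_wordProd_smul, zero_add]

theorem inversionHom_smul (w : W) (p : W × ZMod 2) :
    cs.inversionHom w • p = (w * p.1 * w⁻¹, p.2 + cs.inversionParity w p.1) := by
  obtain ⟨ω, rfl⟩ := cs.wordProd_surjective w
  rw [inversionHom_wordProd_smul, inversionParity_wordProd]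

theorem inversionParity_mul (x y t : W) :
    cs.inversionParity (x * y) t =
      cs.inversionParity y t + cs.inversionParity x (y * t * y⁻¹) := by
  rw [inversionParity, map_mul, mul_smul, inversionHom_smul, inversionHom_smul,
    zero_add]

theorem inversionParity_one (t : W) : cs.inversionParity 1 t = 0 := by
  simp [inversionParity]

theorem IsReflection.inversionParity_self {cs : CoxeterSystem M W} {t : W}
    (ht : cs.IsReflection t) : cs.inversionParity t t = 1 := by
  obtain ⟨w, i, rfl⟩ := ht
  have h := cs.inversionParity_mul w w⁻¹ (w * cs.simple i * w⁻¹)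
  rw [mul_inv_cancel, inversionParity_one] at h
  have hs : cs.inversionParity (cs.simple i) (cs.simple i) = 1 := by
    simp [inversionParity, inversionHom_simple, inversionStep, Function.End.smul_def]
  have e : w⁻¹ * (w * cs.simple i * w⁻¹) * w⁻¹⁻¹ = cs.simple i := by group
  rw [e] at h
  rw [inversionParity_mul, e, inversionParity_mul, mul_inv_cancel_right, hs, add_left_comm, ← h,
    add_zero]

theorem mem_rightInvSeq_of_inversionParity {ω : List B} {t : W}
    (h : cs.inversionParity (cs.wordProd ω) t = 1) : t ∈ cs.rightInvSeq ω := by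
  classical
  by_contra ht
  rw [inversionParity_wordProd, List.count_eq_zero_of_not_mem ht] at h
  simp at h

theorem length_mul_lt_of_inversionParity {w t : W} (h : cs.inversionParity w t = 1) :
    cs.length (w * t) < cs.length w := by
  obtain ⟨ω, hω, rfl⟩ := cs.exists_isReduced w
  exact (cs.isRightInversion_of_mem_rightInvSeq hω (cs.mem_rightInvSeq_of_inversionParity h)).2

theorem IsReflection.inversionParity_eq_one_iff {cs : CoxeterSystem M W} {t : W}
    (ht : cs.IsReflection t) {w : W} :
    cs.inversionParity w t = 1 ↔ cs.length (w * t) < cs.length w := by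
  refine ⟨cs.length_mul_lt_of_inversionParity, fun h ↦ ?_⟩
  by_contra hw
  have h₀ : cs.inversionParity w t = 0 := by
    generalize cs.inversionParity w t = x at hw
    revert x
    decide
  have h₁ : cs.inversionParity (w * t) t = 1 := by
    rw [inversionParity_mul, ht.inversionParity_self, mul_inv_cancel_right, h₀, add_zero]
  have h₂ := cs.length_mul_lt_of_inversionParity h₁
  rw [mul_assoc, ht.mul_self, mul_one] at h₂
  exact h.asymm h₂

/-- The strong exchange condition. -/
theorem IsRightInversion.mem_rightInvSeq {cs : CoxeterSystem M W} {ω : List B} {t : W}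
    (h : cs.IsRightInversion (cs.wordProd ω) t) : t ∈ cs.rightInvSeq ω :=
  cs.mem_rightInvSeq_of_inversionParity (h.1.inversionParity_eq_one_iff.2 h.2)

/-- A right inversion of a product is inherited from one of the factors. -/
theorem IsRightInversion.of_mul {cs : CoxeterSystem M W} {x y t : W}
    (h : cs.IsRightInversion (x * y) t) :
    cs.IsRightInversion y t ∨ cs.IsRightInversion x (y * t * y⁻¹) := by
  have ht := h.1
  by_contra! hn
  have h₁ := ht.inversionParity_eq_one_iff.2 h.2
  have hy : cs.inversionParity y t ≠ 1 := fun e ↦ hn.1 ⟨ht, ht.inversionParity_eq_one_iff.1 e⟩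
  have hx : cs.inversionParity x (y * t * y⁻¹) ≠ 1 :=
    fun e ↦ hn.2 ⟨ht.conj y, (ht.conj y).inversionParity_eq_one_iff.1 e⟩
  rw [inversionParity_mul] at h₁
  generalize cs.inversionParity y t = a at h₁ hy
  generalize cs.inversionParity x (y * t * y⁻¹) = b at h₁ hx
  revert a b
  decide

/-! ### Parabolic subgroups -/

theorem simple_mem_parabolic {J : Set B} {i : B} (hi : i ∈ J) : cs.simple i ∈ cs.parabolic J :=
  Subgroup.subset_closure ⟨i, hi, rfl⟩

theorem wordProd_mem_parabolic {J : Set B} {ω : List B} (hω : ∀ i ∈ ω, i ∈ J) :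
    cs.wordProd ω ∈ cs.parabolic J := by
  refine Subgroup.list_prod_mem _ fun x hx ↦ ?_
  obtain ⟨i, hi, rfl⟩ := List.mem_map.1 hx
  exact cs.simple_mem_parabolic (hω i hi)

theorem parabolic_mono {H I : Set B} (h : H ⊆ I) : cs.parabolic H ≤ cs.parabolic I :=
  Subgroup.closure_mono (Set.image_mono h)

/-- Every element of a parabolic subgroup has a reduced word with letters in the corresponding
set of generators. -/
theorem exists_isReduced_of_mem_parabolic {J : Set B} {v : W} (hv : v ∈ cs.parabolic J) :
    ∃ ω : List B, (∀ i ∈ ω, i ∈ J) ∧ cs.IsReduced ω ∧ v = cs.wordProd ω := by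
  have step : ∀ i ∈ J, ∀ ω : List B, (∀ k ∈ ω, k ∈ J) → cs.IsReduced ω →
      ∃ ω' : List B, (∀ k ∈ ω', k ∈ J) ∧ cs.IsReduced ω' ∧
        cs.simple i * cs.wordProd ω = cs.wordProd ω' := by
    intro i hi ω hJ hω
    rcases cs.length_simple_mul (cs.wordProd ω) i with h | h
    · refine ⟨i :: ω, by simpa [hi] using hJ, ?_, (cs.wordProd_cons i ω).symm⟩
      rw [IsReduced, wordProd_cons, h, hω.eq, List.length_cons]
    · have hinv : cs.IsRightInversion (cs.wordProd ω.reverse) (cs.simple i) := by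
        rw [wordProd_reverse, isRightInversion_inv_iff]
        exact ⟨cs.isReflection_simple i, by omega⟩
      have hmem := hinv.mem_rightInvSeq
      rw [rightInvSeq_reverse, List.mem_reverse, List.mem_iff_getElem] at hmem
      obtain ⟨k, hk, hki⟩ := hmem
      have e : cs.simple i * cs.wordProd ω = cs.wordProd (ω.eraseIdx k) := by
        rw [← getD_leftInvSeq_mul_wordProd, List.getD_eq_getElem _ _ hk, hki]
      refine ⟨ω.eraseIdx k, fun m hm ↦ hJ m (List.mem_of_mem_eraseIdx hm), ?_, e⟩
      rw [length_leftInvSeq] at hk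
      rw [IsReduced, ← e, List.length_eraseIdx_of_lt hk]
      have := hω.eq
      omega
  induction hv using Subgroup.closure_induction_left with
  | one => exact ⟨[], by simp, by simp [IsReduced], by simp⟩
  | mul_left x hx y _ ih =>
    obtain ⟨i, hi, rfl⟩ := hx
    obtain ⟨ω, hJ, hω, rfl⟩ := ih
    exact step i hi ω hJ hω
  | inv_mul_cancel x hx y _ ih =>
    obtain ⟨i, hi, rfl⟩ := hx
    obtain ⟨ω, hJ, hω, rfl⟩ := ih
    rw [inv_simple]
    exact step i hi ω hJ hω

theorem exists_isRightDescent_of_mem_parabolic {J : Set B} {v : W} (hv : v ∈ cs.parabolic J)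
    (h₁ : v ≠ 1) : ∃ i ∈ J, cs.IsRightDescent v i := by
  obtain ⟨ω, hJ, hω, h⟩ := cs.exists_isReduced_of_mem_parabolic (inv_mem hv)
  cases ω with
  | nil => simp [h₁] at h
  | cons i ω =>
    refine ⟨i, hJ i (by simp), ?_⟩
    rw [← isLeftDescent_inv_iff, h, IsLeftDescent, hω.eq, wordProd_cons,
      simple_mul_simple_cancel_left, List.length_cons]
    exact Nat.lt_succ_of_le (cs.length_wordProd_le ω)

theorem IsRightInversion.mem_parabolic {cs : CoxeterSystem M W} {J : Set B} {v t : W}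
    (h : cs.IsRightInversion v t) (hv : v ∈ cs.parabolic J) : t ∈ cs.parabolic J := by
  obtain ⟨ω, hJ, -, rfl⟩ := cs.exists_isReduced_of_mem_parabolic hv
  obtain ⟨k, hk, rfl⟩ := List.mem_iff_getElem.1 h.mem_rightInvSeq
  have e := cs.wordProd_mul_getD_rightInvSeq ω k
  rw [List.getD_eq_getElem _ _ hk, ← eq_inv_mul_iff_mul_eq] at e
  rw [e]
  exact mul_mem (inv_mem hv)
    (cs.wordProd_mem_parabolic fun m hm ↦ hJ m (List.mem_of_mem_eraseIdx hm))

theorem exists_simple_of_mem_parabolic_of_length_eq_one {J : Set B} {v : W}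
    (hv : v ∈ cs.parabolic J) (h : cs.length v = 1) : ∃ i ∈ J, v = cs.simple i := by
  obtain ⟨ω, hJ, hω, rfl⟩ := cs.exists_isReduced_of_mem_parabolic hv
  obtain ⟨i, rfl⟩ := List.length_eq_one_iff.1 (hω.eq.symm.trans h)
  exact ⟨i, hJ i (by simp), cs.wordProd_singleton i⟩

theorem exists_minimal_mul_parabolic (J : Set B) (x : W) :
    ∃ v ∈ cs.parabolic J, ∀ h ∈ cs.parabolic J,
      cs.length (x * v) ≤ cs.length (x * v * h) := by
  let f : cs.parabolic J → ℕ := fun v ↦ cs.length (x * v)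
  refine ⟨(Function.argmin f : cs.parabolic J), (Function.argmin f).2, fun h hh ↦ ?_⟩
  have := Function.argmin_le f (Function.argmin f * ⟨h, hh⟩)
  simpa [f, mul_assoc] using this

theorem length_mul_of_minimal {J : Set B} {x v : W}
    (hx : ∀ h ∈ cs.parabolic J, cs.length x ≤ cs.length (x * h)) (hv : v ∈ cs.parabolic J) :
    cs.length (x * v) = cs.length x + cs.length v := by
  obtain ⟨ω, hJ, hω, rfl⟩ := cs.exists_isReduced_of_mem_parabolic hv
  clear hv
  induction ω using List.reverseRecOn with
  | nil => simp
  | append_singleton ω i ih =>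
    have hω' : cs.IsReduced ω := by simpa using hω.take ω.length
    have hJ' : ∀ k ∈ ω, k ∈ J := fun k hk ↦ hJ k (by simp [hk])
    have hl := hω.eq
    rw [wordProd_append, wordProd_singleton, List.length_append, List.length_singleton] at hl
    have ih := ih hJ' hω'
    rw [wordProd_append, wordProd_singleton, ← mul_assoc, hl]
    rw [hω'.eq] at ih
    rcases cs.length_mul_simple (x * cs.wordProd ω) i with h | h
    · omega
    · exfalso
      have hinv : cs.IsRightInversion (x * cs.wordProd ω) (cs.simple i) :=
        ⟨cs.isReflection_simple i, by omega⟩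
      rcases hinv.of_mul with h' | h'
      · have := h'.2
        rw [hl, hω'.eq] at this
        omega
      · have hmem := cs.wordProd_mem_parabolic hJ'
        exact (hx _ (mul_mem (mul_mem hmem (cs.simple_mem_parabolic (hJ i (by simp))))
          (inv_mem hmem))).not_gt h'.2

theorem minimal_of_forall_not_isRightDescent {J : Set B} {x : W}
    (hx : ∀ j ∈ J, ¬ cs.IsRightDescent x j) :
    ∀ h ∈ cs.parabolic J, cs.length x ≤ cs.length (x * h) := by
  obtain ⟨v, hv, hmin⟩ := cs.exists_minimal_mul_parabolic J x
  suffices v = 1 by simpa [this] using hmin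
  by_contra hne
  obtain ⟨j, hj, hd⟩ := cs.exists_isRightDescent_of_mem_parabolic (inv_mem hv) (inv_ne_one.2 hne)
  refine hx j hj ?_
  have h₁ := cs.length_mul_of_minimal hmin (inv_mem hv)
  have h₂ := cs.length_mul_of_minimal hmin (mul_mem (inv_mem hv) (cs.simple_mem_parabolic hj))
  rw [mul_inv_cancel_right] at h₁
  rw [← mul_assoc, mul_inv_cancel_right] at h₂
  rw [IsRightDescent] at hd ⊢
  omega

theorem length_mul_of_forall_not_isRightDescent {J : Set B} {x v : W}
    (hx : ∀ j ∈ J, ¬ cs.IsRightDescent x j) (hv : v ∈ cs.parabolic J) :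
    cs.length (x * v) = cs.length x + cs.length v :=
  cs.length_mul_of_minimal (cs.minimal_of_forall_not_isRightDescent hx) hv

theorem length_mul_of_forall_not_isLeftDescent {I : Set B} {x u : W}
    (hx : ∀ i ∈ I, ¬ cs.IsLeftDescent x i) (hu : u ∈ cs.parabolic I) :
    cs.length (u * x) = cs.length u + cs.length x := by
  have h := cs.length_mul_of_forall_not_isRightDescent (x := x⁻¹)
    (fun i hi ↦ cs.isRightDescent_inv_iff.not.2 (hx i hi)) (inv_mem hu)
  rwa [← mul_inv_rev, length_inv, length_inv, length_inv, add_comm] at h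

/-- Two elements of the same left coset of `W_J` without right descents in `J` are equal. -/
theorem eq_of_mul_eq_mul_of_forall_not_isRightDescent {J : Set B} {x x' v v' : W}
    (hx : ∀ j ∈ J, ¬ cs.IsRightDescent x j) (hx' : ∀ j ∈ J, ¬ cs.IsRightDescent x' j)
    (hv : v ∈ cs.parabolic J) (hv' : v' ∈ cs.parabolic J) (h : x * v = x' * v') :
    v = v' := by
  have h₁ := cs.length_mul_of_forall_not_isRightDescent hx (mul_mem hv (inv_mem hv'))
  have h₂ := cs.length_mul_of_forall_not_isRightDescent hx' (mul_mem hv' (inv_mem hv))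
  rw [← mul_assoc, h, mul_inv_cancel_right] at h₁
  rw [← mul_assoc, ← h, mul_inv_cancel_right] at h₂
  exact mul_inv_eq_one.1 (cs.length_eq_zero_iff.1 (by omega))

/-- If `w` has no left descents in `I` and no right descents in `J`, then, for `u` in `W_I`, the
product `u * w` has no right descents in `J` iff `u` is minimal in its coset of `W_H`, where
`H = I ∩ w J w⁻¹`. -/
theorem forall_not_isRightDescent_mul_iff {I J H : Set B} {w u : W}
    (hI : ∀ i ∈ I, ¬ cs.IsLeftDescent w i) (hJ : ∀ j ∈ J, ¬ cs.IsRightDescent w j)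
    (hH : H = {s ∈ I | ∃ t ∈ J, cs.simple s = w * cs.simple t * w⁻¹})
    (hu : u ∈ cs.parabolic I) :
    (∀ j ∈ J, ¬ cs.IsRightDescent (u * w) j) ↔
      ∀ h ∈ cs.parabolic H, cs.length u ≤ cs.length (u * h) := by
  subst hH
  refine ⟨fun h ↦ cs.minimal_of_forall_not_isRightDescent ?_, fun h j hj hd ↦ ?_⟩
  · rintro i ⟨hi, j, hj, hij⟩ hd
    refine h j hj ?_
    have e : u * w * cs.simple j = u * cs.simple i * w := by rw [hij]; group
    rw [IsRightDescent] at hd ⊢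
    rw [e, cs.length_mul_of_forall_not_isLeftDescent hI hu,
      cs.length_mul_of_forall_not_isLeftDescent hI (mul_mem hu (cs.simple_mem_parabolic hi))]
    omega
  · have hinv : cs.IsRightInversion (u * w) (cs.simple j) := ⟨cs.isReflection_simple j, hd⟩
    rcases hinv.of_mul with h' | h'
    · exact hJ j hj h'.2
    · have hr := h'.mem_parabolic hu
      have hl := cs.length_mul_of_forall_not_isLeftDescent hI hr
      rw [inv_mul_cancel_right, cs.not_isRightDescent_iff.1 (hJ j hj)] at hl
      obtain ⟨i, hi, hij⟩ :=
        cs.exists_simple_of_mem_parabolic_of_length_eq_one hr (by omega)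
      have hlt := h'.2
      rw [hij] at hlt
      exact (h _ (cs.simple_mem_parabolic ⟨hi, j, hj, hij.symm⟩)).not_gt hlt

theorem conj_mem_parabolic {J H : Set B} {w h : W}
    (hH : ∀ i ∈ H, ∃ j ∈ J, cs.simple i = w * cs.simple j * w⁻¹)
    (hh : h ∈ cs.parabolic H) : w⁻¹ * h * w ∈ cs.parabolic J := by
  have hle : cs.parabolic H ≤ (cs.parabolic J).comap (MulAut.conj w⁻¹).toMonoidHom := by
    refine (Subgroup.closure_le _).2 ?_
    rintro _ ⟨i, hi, rfl⟩
    obtain ⟨j, hj, hij⟩ := hH i hi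
    simpa [hij, mul_assoc] using cs.simple_mem_parabolic hj
  simpa using hle hh

end CoxeterSystem

/-- Double parabolic decomposition.  Let `w` have every element of `I` as a left ascent and
every element of `J` as a right ascent, and let `H = I ∩ (w J w⁻¹)`.  Then (1) for
`u ∈ W_I`, the element `u * w` has no right descent in `J` iff `u` is the minimal-length
representative of its coset `u W_H`; and (2) every element of `W_I w W_J` can be written
uniquely as `u * w * v` with `u ∈ W_I` minimal in `u W_H`, `v ∈ W_J`, and
`ℓ(u w v) = ℓ(u) + ℓ(w) + ℓ(v)`. -/
theorem double_parabolic_decomposition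
    [Fintype B] {M : CoxeterMatrix B} (cs : CoxeterSystem M W)
    (I J : Set B) (w : W)
    (hI : ∀ s ∈ I, cs.length w < cs.length (cs.simple s * w))
    (hJ : ∀ s ∈ J, cs.length w < cs.length (w * cs.simple s))
    (H : Set B) (hH : H = {s ∈ I | ∃ t ∈ J, cs.simple s = w * cs.simple t * w⁻¹}) :
    (∀ u ∈ cs.parabolic I,
      ((∀ j ∈ J, ¬ cs.length (u * w * cs.simple j) < cs.length (u * w)) ↔
        (∀ h ∈ cs.parabolic H, cs.length u ≤ cs.length (u * h)))) ∧
    (∀ y ∈ cs.doubleCoset I w J,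
      ∃! p : W × W,
        p.1 ∈ cs.parabolic I ∧
        (∀ h ∈ cs.parabolic H, cs.length p.1 ≤ cs.length (p.1 * h)) ∧
        p.2 ∈ cs.parabolic J ∧
        y = p.1 * w * p.2 ∧
        cs.length y = cs.length p.1 + cs.length w + cs.length p.2) := by
  have hI' : ∀ i ∈ I, ¬ cs.IsLeftDescent w i := fun i hi ↦ (hI i hi).asymm
  have hJ' : ∀ j ∈ J, ¬ cs.IsRightDescent w j := fun j hj ↦ (hJ j hj).asymm
  have key : ∀ u ∈ cs.parabolic I, ((∀ j ∈ J, ¬ cs.IsRightDescent (u * w) j) ↔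
      ∀ h ∈ cs.parabolic H, cs.length u ≤ cs.length (u * h)) :=
    fun u hu ↦ cs.forall_not_isRightDescent_mul_iff hI' hJ' hH hu
  refine ⟨key, ?_⟩
  rintro y ⟨a, ha, b, hb, rfl⟩
  obtain ⟨h, hh, hmin⟩ := cs.exists_minimal_mul_parabolic H a
  have hHI : H ⊆ I := hH ▸ Set.sep_subset _ _
  have hHJ : ∀ i ∈ H, ∃ j ∈ J, cs.simple i = w * cs.simple j * w⁻¹ := by
    subst hH
    exact fun i hi ↦ hi.2
  have hu : a * h ∈ cs.parabolic I := mul_mem ha (cs.parabolic_mono hHI hh)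
  have hv : w⁻¹ * h⁻¹ * w * b ∈ cs.parabolic J :=
    mul_mem (cs.conj_mem_parabolic hHJ (inv_mem hh)) hb
  have hy : a * w * b = a * h * w * (w⁻¹ * h⁻¹ * w * b) := by group
  refine ⟨(a * h, w⁻¹ * h⁻¹ * w * b), ⟨hu, hmin, hv, hy, ?_⟩, ?_⟩
  · rw [hy, cs.length_mul_of_forall_not_isRightDescent ((key _ hu).2 hmin) hv,
      cs.length_mul_of_forall_not_isLeftDescent hI' hu]
  · rintro ⟨u', v'⟩ ⟨hu', hmin', hv', hy', -⟩
    have hvv : v' = w⁻¹ * h⁻¹ * w * b :=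
      cs.eq_of_mul_eq_mul_of_forall_not_isRightDescent ((key _ hu').2 hmin')
        ((key _ hu).2 hmin) hv' hv (hy'.symm.trans hy)
    refine Prod.ext ?_ hvv
    have huu := hy'.symm.trans hy
    dsimp only at huu
    rw [hvv] at huu
    exact mul_right_cancel (mul_right_cancel huu)
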